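/- Well-definedness of λ₁(α): Let f : ℝⁿ → ℝⁿ be twice continuously differentiable and let α be a simple zero of f. Suppose the critical set Σ = {x ∈ ℝⁿ : det J(x) = 0} is nonempty, and let r* be the Euclidean distance from α to Σ (so r* > 0 since the critical set is closed and α is not in it). For r ∈ [0, r*/(2√n)) let Δ_r denote the closed Euclidean ball of radius 2√n·r centered at α and define h(r) := sup{ ‖ |J(x)⁻¹| · K(Δ_r) ‖ : x ∈ Δ_r }, where |J(x)⁻¹| denotes the entrywise absolute value of the matrix J(x)⁻¹. Then the set { r ∈ (0, r*/(2√n)) : 27·n·r·h(r) = 1 } is nonempty and has a least element λ₁(α) > 0. -/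

import Mathlib

/-- The partial derivative `∂f_i/∂x_j` at `x`. -/
noncomputable def pd (n : ℕ) (f : (Fin n → ℝ) → (Fin n → ℝ)) (i j : Fin n)
    (x : Fin n → ℝ) : ℝ :=
  fderiv ℝ (fun y => f y i) x (Pi.single j 1)

/-- The Jacobian matrix of `f` at `x`. -/
noncomputable def Jmat (n : ℕ) (f : (Fin n → ℝ) → (Fin n → ℝ))
    (x : Fin n → ℝ) : Matrix (Fin n) (Fin n) ℝ :=
  fun i j => pd n f i j x

/-- The matrix `K(C)` with entries `K(C)_{ij} = Σ_k sup_{x∈C} |∂²f_i/(∂x_j∂x_k)(x)|`. -/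
noncomputable def Kmat (n : ℕ) (f : (Fin n → ℝ) → (Fin n → ℝ))
    (C : Set (Fin n → ℝ)) : Matrix (Fin n) (Fin n) ℝ :=
  fun i j => ∑ k, sSup ((fun x => |fderiv ℝ (pd n f i j) x (Pi.single k 1)|) '' C)

/-- The maximum-absolute-row-sum norm of a matrix (the operator norm induced
by the `ℓ∞` norm on `ℝⁿ`). -/
noncomputable def rowSumNorm (n : ℕ) (A : Matrix (Fin n) (Fin n) ℝ) : ℝ :=
  ⨆ i, ∑ j, |A i j|

/-- The Euclidean distance on `Fin n → ℝ`. -/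
noncomputable def eudist (n : ℕ) (x y : Fin n → ℝ) : ℝ :=
  Real.sqrt (∑ i, (x i - y i) ^ 2)

open Set Filter Topology

lemma eudist_add_smul (n : ℕ) (a u : Fin n → ℝ) (s : ℝ) :
    eudist n a (a + s • u) = |s| * eudist n 0 u := by
  unfold eudist
  rw [← Real.sqrt_sq_eq_abs, ← Real.sqrt_mul (sq_nonneg s), Finset.mul_sum]
  congr 1
  refine Finset.sum_congr rfl fun i _ => ?_
  simp only [Pi.add_apply, Pi.smul_apply, Pi.zero_apply, smul_eq_mul]
  ring

lemma norm_sub_le_eudist (n : ℕ) (x y : Fin n → ℝ) : ‖x - y‖ ≤ eudist n x y := by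
  refine (pi_norm_le_iff_of_nonneg (Real.sqrt_nonneg _)).2 fun i => ?_
  rw [Real.norm_eq_abs]
  refine Real.abs_le_sqrt ?_
  exact Finset.single_le_sum (f := fun i => (x i - y i) ^ 2) (fun i _ => sq_nonneg _)
    (Finset.mem_univ i)

lemma continuous_eudist (n : ℕ) (a : Fin n → ℝ) : Continuous (eudist n a) := by
  unfold eudist
  fun_prop

lemma isCompact_eudist_le (n : ℕ) (a : Fin n → ℝ) (c : ℝ) :
    IsCompact {x | eudist n a x ≤ c} := by
  refine (isCompact_closedBall a c).of_isClosed_subset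
    (isClosed_le (continuous_eudist n a) continuous_const) fun x hx => ?_
  rw [Metric.mem_closedBall, dist_comm, dist_eq_norm]
  exact (norm_sub_le_eudist n a x).trans hx

lemma bddBelow_eudist_image (n : ℕ) (a : Fin n → ℝ) (S : Set (Fin n → ℝ)) :
    BddBelow ((fun x => eudist n a x) '' S) :=
  ⟨0, by rintro _ ⟨x, -, rfl⟩; exact Real.sqrt_nonneg _⟩

/-- The Euclidean distance to a nonempty closed set is attained. -/
lemma exists_eudist_eq_sInf (n : ℕ) (a : Fin n → ℝ) {S : Set (Fin n → ℝ)}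
    (hS : IsClosed S) (hne : S.Nonempty) :
    ∃ b ∈ S, eudist n a b = sInf ((fun x => eudist n a x) '' S) := by
  obtain ⟨x₀, hx₀⟩ := hne
  have hx₀' : x₀ ∈ {x | eudist n a x ≤ eudist n a x₀} := le_refl (eudist n a x₀)
  obtain ⟨b, hb, hmin⟩ := ((isCompact_eudist_le n a (eudist n a x₀)).inter_right
    hS).exists_isMinOn ⟨x₀, hx₀', hx₀⟩ (continuous_eudist n a).continuousOn
  refine ⟨b, hb.2, le_antisymm (le_csInf ⟨_, mem_image_of_mem _ hb.2⟩ ?_)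
    (csInf_le (bddBelow_eudist_image n a S) (mem_image_of_mem _ hb.2))⟩
  rintro _ ⟨x, hx, rfl⟩
  rcases le_total (eudist n a x) (eudist n a x₀) with hle | hle
  · exact hmin ⟨hle, hx⟩
  · exact le_trans hb.1 hle

/-- Euclidean balls are affine images of the unit ball. -/
lemma eudist_ball_eq_image (n : ℕ) (a : Fin n → ℝ) {s : ℝ} (hs : 0 ≤ s) :
    {x | eudist n a x ≤ s} = (fun u => a + s • u) '' {u | eudist n 0 u ≤ 1} := by
  ext x
  constructor
  · intro hx
    rcases hs.eq_or_lt with rfl | hs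
    · refine ⟨0, by simp [eudist], ?_⟩
      have h1 : ‖a - x‖ ≤ 0 := (norm_sub_le_eudist n a x).trans hx
      have h2 : a - x = 0 := norm_le_zero_iff.1 h1
      simpa using sub_eq_zero.1 h2
    · have h1 : a + s • (s⁻¹ • (x - a)) = x := by
        rw [smul_inv_smul₀ hs.ne']
        abel
      refine ⟨s⁻¹ • (x - a), ?_, h1⟩
      have h2 := eudist_add_smul n a (s⁻¹ • (x - a)) s
      rw [h1, abs_of_pos hs] at h2
      have h3 : s * eudist n 0 (s⁻¹ • (x - a)) ≤ s * 1 := by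
        rw [← h2, mul_one]
        exact hx
      exact le_of_mul_le_mul_left h3 hs
  · rintro ⟨u, hu, rfl⟩
    rw [mem_ofPred_eq, eudist_add_smul, abs_of_nonneg hs]
    exact mul_le_of_le_one_right hs hu

lemma contDiff_pd {n : ℕ} {f : (Fin n → ℝ) → (Fin n → ℝ)} (hf : ContDiff ℝ 2 f)
    (i j : Fin n) : ContDiff ℝ 1 (pd n f i j) := by
  have h1 : ContDiff ℝ 2 (fun y => f y i) := contDiff_pi.1 hf i
  exact (h1.fderiv_right (m := 1) (by norm_num)).clm_apply contDiff_const

lemma continuous_Jmat {n : ℕ} {f : (Fin n → ℝ) → (Fin n → ℝ)} (hf : ContDiff ℝ 2 f) :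
    Continuous (Jmat n f) :=
  continuous_matrix fun i j => (contDiff_pd hf i j).continuous

lemma continuous_abs_fderiv_pd {n : ℕ} {f : (Fin n → ℝ) → (Fin n → ℝ)}
    (hf : ContDiff ℝ 2 f) (i j k : Fin n) :
    Continuous fun x => |fderiv ℝ (pd n f i j) x (Pi.single k 1)| :=
  (((contDiff_pd hf i j).continuous_fderiv one_ne_zero).clm_apply continuous_const).abs

lemma continuous_rowSumNorm {n : ℕ} (hn : 0 < n) : Continuous (rowSumNorm n) := by
  have : Nonempty (Fin n) := ⟨⟨0, hn⟩⟩
  have h1 : rowSumNorm n = fun A => Finset.univ.sup' Finset.univ_nonempty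
      fun i => ∑ j, |A i j| := by
    funext A
    rw [Finset.sup'_univ_eq_ciSup]
    rfl
  rw [h1]
  refine Continuous.finset_sup'_apply _ fun i _ => ?_
  exact continuous_finsetSum _ fun j _ => (continuous_id.matrix_elem i j).abs

lemma row_sum_le_rowSumNorm {n : ℕ} (A : Matrix (Fin n) (Fin n) ℝ) (i : Fin n) :
    ∑ j, |A i j| ≤ rowSumNorm n A :=
  le_ciSup (f := fun i => ∑ j, |A i j|) (finite_range _).bddAbove i

lemma continuousOn_Jmat_inv {n : ℕ} {f : (Fin n → ℝ) → (Fin n → ℝ)} (hf : ContDiff ℝ 2 f) :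
    ContinuousOn (fun x => (Jmat n f x)⁻¹) {x | (Jmat n f x).det ≠ 0} := by
  simp only [Matrix.inv_def, Ring.inverse_eq_inv']
  exact ((continuous_Jmat hf).matrix_det.continuousOn.inv₀ fun x hx => hx).smul
    (continuous_Jmat hf).matrix_adjugate.continuousOn

/-- `K` of the unit ball scaled by `s` and translated to `a` depends continuously on `s`. -/
lemma continuous_Kmat_image {n : ℕ} {f : (Fin n → ℝ) → (Fin n → ℝ)} (hf : ContDiff ℝ 2 f)
    (a : Fin n → ℝ) {B : Set (Fin n → ℝ)} (hB : IsCompact B) :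
    Continuous fun s : ℝ => Kmat n f ((fun u => a + s • u) '' B) := by
  refine continuous_matrix fun i j => ?_
  unfold Kmat
  refine continuous_finsetSum _ fun k _ => ?_
  simp only [image_image]
  refine hB.continuous_sSup
    (f := fun (s : ℝ) u => |fderiv ℝ (pd n f i j) (a + s • u) (Pi.single k 1)|) ?_
  exact (continuous_abs_fderiv_pd hf i j k).comp
    (by fun_prop : Continuous fun p : ℝ × (Fin n → ℝ) => a + p.1 • p.2)

/-- The supremum over a fixed compact set of a jointly continuous function is continuous in the
parameter, relative to a set of parameters. -/
lemma continuousOn_sSup_image {X Y : Type*} [TopologicalSpace X] [TopologicalSpace Y]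
    {S : Set X} {B : Set Y} (hB : IsCompact B) {F : X → Y → ℝ}
    (hF : ContinuousOn (fun p : X × Y => F p.1 p.2) (S ×ˢ B)) :
    ContinuousOn (fun r => sSup (F r '' B)) S := by
  rw [continuousOn_iff_continuous_domRestrict]
  have : CompactSpace B := isCompact_iff_compactSpace.1 hB
  have heq : S.domRestrict (fun r => sSup (F r '' B)) =
      fun r : S => sSup ((fun u : B => F r u) '' univ) := by
    funext r
    rw [domRestrict_apply, image_univ, image_eq_range]
  rw [heq]
  exact isCompact_univ.continuous_sSup (f := fun (r : S) (u : B) => F r u)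
    (hF.comp_continuous (f := fun p : S × B => ((p.1 : X), (p.2 : Y))) (by fun_prop)
      fun p => ⟨p.1.2, p.2.2⟩)

lemma rowSumNorm_nonneg {n : ℕ} (A : Matrix (Fin n) (Fin n) ℝ) : 0 ≤ rowSumNorm n A :=
  Real.iSup_nonneg fun _ => Finset.sum_nonneg fun _ _ => abs_nonneg _

lemma continuous_rowSumNorm_abs_mul {n : ℕ} (hn : 0 < n) :
    Continuous fun p : Matrix (Fin n) (Fin n) ℝ × Matrix (Fin n) (Fin n) ℝ =>
      rowSumNorm n ((p.1.map fun a => |a|) * p.2) :=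
  (continuous_rowSumNorm hn).comp
    ((continuous_fst.matrix_map continuous_abs).matrix_mul continuous_snd)

/-- If the Jacobian is invertible on the affine images `a + (c r) B` for `r ∈ S`, then the
supremum of `‖|J⁻¹| K‖` over these images is continuous in `r ∈ S`. -/
lemma continuousOn_sSup_rowSumNorm {n : ℕ} (hn : 0 < n) {f : (Fin n → ℝ) → (Fin n → ℝ)}
    (hf : ContDiff ℝ 2 f) (a : Fin n → ℝ) {B : Set (Fin n → ℝ)} (hB : IsCompact B) (c : ℝ)
    {S : Set ℝ} (hdet : ∀ r ∈ S, ∀ u ∈ B, (Jmat n f (a + (c * r) • u)).det ≠ 0) :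
    ContinuousOn (fun r => sSup ((fun x => rowSumNorm n (((Jmat n f x)⁻¹.map fun t => |t|) *
      Kmat n f ((fun u => a + (c * r) • u) '' B))) '' ((fun u => a + (c * r) • u) '' B))) S := by
  simp only [image_image (fun x => rowSumNorm n _)]
  refine continuousOn_sSup_image hB (F := fun r u => rowSumNorm n
    (((Jmat n f (a + (c * r) • u))⁻¹.map fun t => |t|) *
      Kmat n f ((fun u => a + (c * r) • u) '' B))) ?_
  have hK : Continuous fun p : ℝ × (Fin n → ℝ) =>
      Kmat n f ((fun u => a + (c * p.1) • u) '' B) :=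
    (continuous_Kmat_image hf a hB).comp
      (by fun_prop : Continuous fun p : ℝ × (Fin n → ℝ) => c * p.1)
  have hJ : ContinuousOn (fun p : ℝ × (Fin n → ℝ) => (Jmat n f (a + (c * p.1) • p.2))⁻¹)
      (S ×ˢ B) :=
    (continuousOn_Jmat_inv hf).comp (by fun_prop) fun p hp => hdet p.1 hp.1 p.2 hp.2
  have hJK := hJ.prodMk (hK.continuousOn (s := S ×ˢ B))
  have hcomp := (continuous_rowSumNorm_abs_mul hn).comp_continuousOn hJK
  exact hcomp

lemma abs_pd_sub_le {n : ℕ} {f : (Fin n → ℝ) → (Fin n → ℝ)} (hf : ContDiff ℝ 2 f)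
    (a b : Fin n → ℝ) {C : Set (Fin n → ℝ)} (hC : IsCompact C) (hab : segment ℝ a b ⊆ C)
    (i j : Fin n) : |pd n f i j a - pd n f i j b| ≤ Kmat n f C i j * ‖a - b‖ := by
  rw [← Real.norm_eq_abs]
  refine (convex_segment a b).norm_image_sub_le_of_norm_fderiv_le (𝕜 := ℝ)
    (fun x _ => ((contDiff_pd hf i j).differentiable one_ne_zero) x) (fun x hx => ?_)
    (right_mem_segment ℝ a b) (left_mem_segment ℝ a b)
  have key : ∀ k, |fderiv ℝ (pd n f i j) x (Pi.single k 1)| ≤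
      sSup ((fun x => |fderiv ℝ (pd n f i j) x (Pi.single k 1)|) '' C) := fun k =>
    le_csSup (hC.image (continuous_abs_fderiv_pd hf i j k)).bddAbove
      (mem_image_of_mem _ (hab hx))
  have hsum : ∑ k, |fderiv ℝ (pd n f i j) x (Pi.single k 1)| ≤ Kmat n f C i j :=
    Finset.sum_le_sum fun k _ => key k
  refine ContinuousLinearMap.opNorm_le_bound _
    ((Finset.sum_nonneg fun k _ => abs_nonneg _).trans hsum) fun v => ?_
  refine le_trans ?_ (mul_le_mul_of_nonneg_right hsum (norm_nonneg v))
  have hv : fderiv ℝ (pd n f i j) x v =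
      ∑ k, v k * fderiv ℝ (pd n f i j) x (Pi.single k 1) := by
    conv_lhs => rw [pi_eq_sum_univ' v]
    simp [map_sum]
  rw [hv, Real.norm_eq_abs, Finset.sum_mul]
  refine (Finset.abs_sum_le_sum_abs _ _).trans (Finset.sum_le_sum fun k _ => ?_)
  rw [abs_mul, mul_comm]
  exact mul_le_mul_of_nonneg_left (norm_le_pi_norm v k) (abs_nonneg _)

/-- A singular Jacobian at `b` forces `|J(a)⁻¹| K(C)` to be at least `1 / ‖a - b‖`. -/
lemma one_le_norm_sub_mul_rowSumNorm {n : ℕ} {f : (Fin n → ℝ) → (Fin n → ℝ)}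
    (hf : ContDiff ℝ 2 f) (a b : Fin n → ℝ) {C : Set (Fin n → ℝ)} (hC : IsCompact C)
    (hab : segment ℝ a b ⊆ C) (ha : (Jmat n f a).det ≠ 0) (hb : (Jmat n f b).det = 0) :
    1 ≤ ‖a - b‖ * rowSumNorm n (((Jmat n f a)⁻¹.map fun t => |t|) * Kmat n f C) := by
  obtain ⟨v, hv0, hv⟩ := Matrix.exists_mulVec_eq_zero_iff.2 hb
  set N := rowSumNorm n (((Jmat n f a)⁻¹.map fun t => |t|) * Kmat n f C) with hN
  have hN0 : 0 ≤ N := rowSumNorm_nonneg _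
  have hv' : v = ((Jmat n f a)⁻¹ * (Jmat n f a - Jmat n f b)).mulVec v := by
    rw [← Matrix.mulVec_mulVec, Matrix.sub_mulVec, hv, sub_zero, Matrix.mulVec_mulVec,
      Matrix.nonsing_inv_mul _ (isUnit_iff_ne_zero.2 ha), Matrix.one_mulVec]
  have hle : ‖v‖ ≤ ‖a - b‖ * N * ‖v‖ := by
    refine (pi_norm_le_iff_of_nonneg (by positivity)).2 fun i => ?_
    have hent : ∀ j, |((Jmat n f a)⁻¹ * (Jmat n f a - Jmat n f b)) i j| ≤
        ‖a - b‖ * |(((Jmat n f a)⁻¹.map fun t => |t|) * Kmat n f C) i j| := by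
      intro j
      refine le_trans ?_ (mul_le_mul_of_nonneg_left (le_abs_self _) (norm_nonneg _))
      rw [Matrix.mul_apply, Matrix.mul_apply, Finset.mul_sum]
      refine (Finset.abs_sum_le_sum_abs _ _).trans (Finset.sum_le_sum fun l _ => ?_)
      rw [abs_mul, Matrix.map_apply]
      calc _ ≤ |(Jmat n f a)⁻¹ i l| * (Kmat n f C l j * ‖a - b‖) :=
            mul_le_mul_of_nonneg_left (abs_pd_sub_le hf a b hC hab l j) (abs_nonneg _)
        _ = _ := by ring
    conv_lhs => rw [hv']
    rw [Matrix.mulVec_eq_sum, Finset.sum_apply, Real.norm_eq_abs]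
    refine (Finset.abs_sum_le_sum_abs _ _).trans ?_
    calc _ ≤ ∑ j, ‖a - b‖ * |(((Jmat n f a)⁻¹.map fun t => |t|) * Kmat n f C) i j| * ‖v‖ := by
          refine Finset.sum_le_sum fun j _ => ?_
          simp only [Pi.smul_apply, MulOpposite.smul_eq_mul_unop,
            MulOpposite.unop_op, abs_mul]
          exact mul_le_mul (hent j) (norm_le_pi_norm v j) (abs_nonneg _) (by positivity)
      _ = ‖a - b‖ * (∑ j, |(((Jmat n f a)⁻¹.map fun t => |t|) * Kmat n f C) i j|) * ‖v‖ := by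
          rw [Finset.mul_sum, Finset.sum_mul]
      _ ≤ _ := by
          gcongr
          exact row_sum_le_rowSumNorm _ i
  have hvpos : 0 < ‖v‖ := norm_pos_iff.2 hv0
  by_contra! hlt
  nlinarith

/-- A continuous function on `[0, R)` vanishing at `0` and exceeding `1` somewhere takes the
value `1` for a first time, at a positive argument. -/
lemma exists_least_eq_one {g : ℝ → ℝ} {R r₁ : ℝ} (hg : ContinuousOn g (Ico 0 R))
    (h0 : g 0 = 0) (hr₁ : r₁ ∈ Ioo 0 R) (h1 : 1 < g r₁) :
    ∃ m ∈ {r ∈ Ioo 0 R | g r = 1}, 0 < m ∧ ∀ r ∈ {r ∈ Ioo 0 R | g r = 1}, m ≤ r := by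
  have hsub : Icc 0 r₁ ⊆ Ico 0 R := fun x hx => ⟨hx.1, hx.2.trans_lt hr₁.2⟩
  have hg' := hg.mono hsub
  have hcomp : IsCompact (Icc 0 r₁ ∩ g ⁻¹' {1}) :=
    isCompact_Icc.of_isClosed_subset (hg'.preimage_isClosed_of_isClosed isClosed_Icc
      isClosed_singleton) inter_subset_left
  have hne : (Icc 0 r₁ ∩ g ⁻¹' {1}).Nonempty := by
    obtain ⟨x, hx, hx1⟩ := intermediate_value_Icc hr₁.1.le hg'
      (show (1 : ℝ) ∈ Icc (g 0) (g r₁) from ⟨by rw [h0]; exact zero_le_one, h1.le⟩)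
    exact ⟨x, hx, hx1⟩
  obtain ⟨m, ⟨hm, hm1⟩, hmin⟩ := hcomp.exists_isLeast hne
  have hm1 : g m = 1 := hm1
  have hm0 : 0 < m := by
    refine hm.1.lt_of_ne ?_
    rintro rfl
    rw [h0] at hm1
    exact zero_ne_one hm1
  refine ⟨m, ⟨⟨hm0, hm.2.trans_lt hr₁.2⟩, hm1⟩, hm0, fun r hr => ?_⟩
  rcases le_total r r₁ with h | h
  · exact hmin ⟨⟨hr.1.1.le, h⟩, hr.2⟩
  · exact hm.2.trans h

/-- **Well-definedness of `λ₁(α)`.** Let `α` be a simple zero of the `C²` map `f`,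
let `Σ` be the (nonempty) critical set, `r*` the Euclidean distance from `α` to `Σ`,
`Δ_r` the closed Euclidean ball of radius `2√n·r` about `α`, and
`h(r) = sup_{x∈Δ_r} ‖|J(x)⁻¹|·K(Δ_r)‖`.  Then
`{ r ∈ (0, r*/(2√n)) : 27·n·r·h(r) = 1 }` is nonempty and has a least element,
which is positive. -/
theorem lambda1_well_defined (n : ℕ) (f : (Fin n → ℝ) → (Fin n → ℝ))
    (hf : ContDiff ℝ 2 f) (α : Fin n → ℝ) (hroot : f α = 0)
    (hsimple : (Jmat n f α).det ≠ 0)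
    (Sig : Set (Fin n → ℝ)) (hSig : Sig = {x | (Jmat n f x).det = 0})
    (hSigne : Sig.Nonempty)
    (rstar : ℝ) (hrstar : rstar = sInf ((fun x => eudist n α x) '' Sig))
    (Δ : ℝ → Set (Fin n → ℝ))
    (hΔ : ∀ r, Δ r = {x | eudist n α x ≤ 2 * Real.sqrt n * r})
    (h : ℝ → ℝ)
    (hh : ∀ r, h r =
      sSup ((fun x => rowSumNorm n (((Jmat n f x)⁻¹.map fun a => |a|) * Kmat n f (Δ r)))
        '' Δ r)) :
    ∃ lam₁ ∈ {r ∈ Set.Ioo 0 (rstar / (2 * Real.sqrt n)) | 27 * n * r * h r = 1},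
      0 < lam₁ ∧
      ∀ r ∈ {r ∈ Set.Ioo 0 (rstar / (2 * Real.sqrt n)) | 27 * n * r * h r = 1},
        lam₁ ≤ r := by
  have hn : 0 < n := by
    rcases Nat.eq_zero_or_pos n with rfl | hn
    · obtain ⟨x, hx⟩ := hSigne
      rw [hSig, mem_ofPred_eq, Matrix.det_isEmpty] at hx
      exact absurd hx one_ne_zero
    · exact hn
  have hn1 : (1 : ℝ) ≤ n := by exact_mod_cast hn
  have hsq : (1 : ℝ) ≤ √n := Real.one_le_sqrt.2 hn1
  have hsq2 : √n * √n = n := Real.mul_self_sqrt (by linarith)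
  have hSigcl : IsClosed Sig := by
    rw [hSig]
    exact isClosed_eq (continuous_Jmat hf).matrix_det continuous_const
  obtain ⟨β, hβ, hβr⟩ := exists_eudist_eq_sInf n α hSigcl hSigne
  rw [← hrstar] at hβr
  have hβdet : (Jmat n f β).det = 0 := by
    rw [hSig] at hβ
    exact hβ
  have hnotin : ∀ x, eudist n α x < rstar → (Jmat n f x).det ≠ 0 := by
    intro x hx hdet
    have hxS : x ∈ Sig := by
      rw [hSig]
      exact hdet
    exact absurd
      (csInf_le (bddBelow_eudist_image n α Sig) (mem_image_of_mem _ hxS))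
      (by rw [← hrstar]; exact hx.not_ge)
  have hrpos : 0 < rstar := by
    rw [← hβr]
    refine lt_of_lt_of_le (norm_pos_iff.2 (sub_ne_zero.2 ?_)) (norm_sub_le_eudist n α β)
    rintro rfl
    exact hsimple hβdet
  set R := rstar / (2 * √n) with hR
  have hRpos : 0 < R := by positivity
  have hRr : 2 * √n * R = rstar := by
    rw [hR]
    field_simp
  set B : Set (Fin n → ℝ) := {u | eudist n 0 u ≤ 1}
  have hB : IsCompact B := isCompact_eudist_le n 0 1
  have hΔB : ∀ r, 0 ≤ r → Δ r = (fun u => α + (2 * √n * r) • u) '' B := fun r hr => by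
    rw [hΔ, eudist_ball_eq_image n α (by positivity)]
  have hlt : ∀ r ∈ Ico 0 R, ∀ x ∈ Δ r, (Jmat n f x).det ≠ 0 := by
    intro r hr x hx
    rw [hΔ] at hx
    refine hnotin x (lt_of_le_of_lt hx ?_)
    rw [← hRr]
    exact mul_lt_mul_of_pos_left hr.2 (by positivity)
  let K : ℝ → Matrix (Fin n) (Fin n) ℝ :=
    fun r => Kmat n f ((fun u => α + (2 * √n * r) • u) '' B)
  have hK : Continuous K := (continuous_Kmat_image hf α hB).comp (by fun_prop)
  have hΦ := continuous_rowSumNorm_abs_mul hn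
  have hcont : ContinuousOn h (Ico 0 R) := by
    refine (continuousOn_sSup_rowSumNorm hn hf α hB (2 * √n) (S := Ico 0 R)
      fun r hr u hu => hlt r hr _ ?_).congr fun r hr => ?_
    · rw [hΔB r hr.1]
      exact mem_image_of_mem _ hu
    · rw [hh, hΔB r hr.1]
  have hkey : 1 ≤ rstar * rowSumNorm n (((Jmat n f α)⁻¹.map fun a => |a|) * K R) := by
    have hseg : segment ℝ α β ⊆ (fun u => α + (2 * √n * R) • u) '' B := by
      rw [hRr, ← eudist_ball_eq_image n α hrpos.le, segment_eq_image']
      rintro _ ⟨t, ht, rfl⟩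
      have h1 := eudist_add_smul n α (β - α) 1
      rw [one_smul, add_sub_cancel, hβr, abs_one, one_mul] at h1
      rw [mem_ofPred_eq, eudist_add_smul, ← h1, abs_of_nonneg ht.1]
      exact mul_le_of_le_one_left hrpos.le ht.2
    have hC : IsCompact ((fun u => α + (2 * √n * R) • u) '' B) :=
      hB.image (by fun_prop)
    refine (one_le_norm_sub_mul_rowSumNorm hf α β hC hseg hsimple hβdet).trans ?_
    refine mul_le_mul_of_nonneg_right ?_ (rowSumNorm_nonneg _)
    rw [← hβr]
    exact norm_sub_le_eudist n α β
  have hαK : Continuous fun r : ℝ => ((Jmat n f α)⁻¹, K r) := continuous_const.prodMk hK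
  have hk := hΦ.comp hαK
  have hkcont : Continuous fun r : ℝ =>
      27 * n * r * rowSumNorm n (((Jmat n f α)⁻¹.map fun a => |a|) * K r) :=
    (by fun_prop : Continuous fun r : ℝ => 27 * n * r).mul hk
  have hkR : 1 < 27 * n * R * rowSumNorm n (((Jmat n f α)⁻¹.map fun a => |a|) * K R) := by
    rw [← hRr] at hkey
    have h1 : 0 ≤ R * rowSumNorm n (((Jmat n f α)⁻¹.map fun a => |a|) * K R) :=
      mul_nonneg hRpos.le (rowSumNorm_nonneg _)
    have h2 : √n ≤ n := by nlinarith
    nlinarith [mul_le_mul_of_nonneg_right h2 h1]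
  obtain ⟨r₁, hr₁, hr₁k⟩ : ∃ r₁ ∈ Ioo 0 R,
      1 < 27 * n * r₁ * rowSumNorm n (((Jmat n f α)⁻¹.map fun a => |a|) * K r₁) := by
    have h1 := (hkcont.continuousAt (x := R)).eventually (lt_mem_nhds hkR)
    have h2 : ∀ᶠ r in 𝓝[<] R, r ∈ Ioo 0 R := Ioo_mem_nhdsLT hRpos
    obtain ⟨r, hr, hr'⟩ := (h2.and (h1.filter_mono nhdsWithin_le_nhds)).exists
    exact ⟨r, hr, hr'⟩
  refine exists_least_eq_one (g := fun r => 27 * n * r * h r) (r₁ := r₁) ?_ (by simp) hr₁ ?_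
  · exact (by fun_prop : Continuous fun r : ℝ => 27 * n * r).continuousOn.mul hcont
  · refine hr₁k.trans_le (mul_le_mul_of_nonneg_left ?_
      (mul_nonneg (by positivity) hr₁.1.le))
    rw [hh]
    have hα : α ∈ Δ r₁ := by
      rw [hΔ, mem_ofPred_eq]
      have : eudist n α α = 0 := by simp [eudist]
      rw [this]
      have := hr₁.1
      positivity
    have hΔc : IsCompact (Δ r₁) := by
      rw [hΔ]
      exact isCompact_eudist_le n α _
    have hJK := ((continuousOn_Jmat_inv hf).mono (hlt r₁ ⟨hr₁.1.le, hr₁.2⟩)).prodMk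
      (continuousOn_const (s := Δ r₁) (c := Kmat n f (Δ r₁)))
    have hco := hΦ.comp_continuousOn hJK
    refine le_csSup (hΔc.image_of_continuousOn hco).bddAbove ⟨α, hα, ?_⟩
    simp only [K]
    rw [← hΔB r₁ hr₁.1.le]
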